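/- If Ω is any proper subdomain of ℂ and Y is a quasi-bounded domain that is a Hurwitz non-Lipschitz subdomain of Ŷ (the smallest simply connected plane domain containing Y), then η_Ω^Y(w) = η_Ω(w) for all w ∈ Ω. -/

import Mathlib

open Complex Set Metric
open scoped ENNReal

noncomputable section

/-- The open unit disk in the complex plane. -/
def unitDisk : Set ℂ := Metric.ball (0 : ℂ) 1

/-- A plane domain: a nonempty open connected subset of ℂ. -/
def IsPlaneDomain (S : Set ℂ) : Prop := IsOpen S ∧ IsConnected S

/-- The Hurwitz radius `r_Ω(w)`: the supremum of `h'(0)` over all holomorphic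
`h : 𝔻 → Ω` with `h 0 = w`, `h t ≠ w` for `t ∈ 𝔻 \ {0}`, and `h'(0) > 0` (real). -/
def hurwitzRadius (Ω : Set ℂ) (w : ℂ) : ℝ :=
  sSup { r : ℝ | 0 < r ∧ ∃ h : ℂ → ℂ, DifferentiableOn ℂ h unitDisk ∧
    Set.MapsTo h unitDisk Ω ∧ h 0 = w ∧ (∀ t ∈ unitDisk, t ≠ 0 → h t ≠ w) ∧
    deriv h 0 = (r : ℂ) }

/-- The Hurwitz density `η_Ω(w) = 2 / r_Ω(w)`. -/
def hurwitzDensity (Ω : Set ℂ) (w : ℂ) : ℝ := 2 / hurwitzRadius Ω w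

/-- A (C¹, hence rectifiable) path in `Ω` from `w₁` to `w₂`, parametrized on `[0,1]`. -/
def IsPathIn (Ω : Set ℂ) (w₁ w₂ : ℂ) (γ : ℝ → ℂ) : Prop :=
  γ 0 = w₁ ∧ γ 1 = w₂ ∧ (∀ t ∈ Set.Icc (0:ℝ) 1, γ t ∈ Ω) ∧
    ContDiffOn ℝ 1 γ (Set.Icc (0:ℝ) 1)

/-- The Hurwitz distance: infimum of Hurwitz lengths of rectifiable paths in `Ω`. -/
def hurwitzDist (Ω : Set ℂ) (w₁ w₂ : ℂ) : ℝ :=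
  sInf { L : ℝ | ∃ γ : ℝ → ℂ, IsPathIn Ω w₁ w₂ γ ∧
    L = ∫ t in (0:ℝ)..1, hurwitzDensity Ω (γ t) * ‖derivWithin γ (Set.Icc (0:ℝ) 1) t‖ }

/-- The generalized Hurwitz density `η_Ω^Y(w)` with basepoint domain `Y`
(`+∞` if no admissible map exists). -/
def genHurwitzDensity (Y Ω : Set ℂ) (w : ℂ) : ℝ≥0∞ :=
  sInf { x : ℝ≥0∞ | ∃ s ∈ Y, ∃ h : ℂ → ℂ, DifferentiableOn ℂ h Y ∧
    Set.MapsTo h Y Ω ∧ h s = w ∧ (∀ t ∈ Y, t ≠ s → h t ≠ w) ∧ deriv h s ≠ 0 ∧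
    x = ENNReal.ofReal (hurwitzDensity Y s / ‖deriv h s‖) }

/-- The generalized Hurwitz distance `η_Ω^Y(z₁,z₂)`. -/
def genHurwitzDist (Y Ω : Set ℂ) (z₁ z₂ : ℂ) : ℝ≥0∞ :=
  sInf { L : ℝ≥0∞ | ∃ γ : ℝ → ℂ, IsPathIn Ω z₁ z₂ γ ∧
    L = ∫⁻ t in Set.Icc (0:ℝ) 1,
      genHurwitzDensity Y Ω (γ t) * ENNReal.ofReal ‖derivWithin γ (Set.Icc (0:ℝ) 1) t‖ }

/-- The infinitesimal contraction constant `l_η(Ω, Y)`. -/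
def lEta (Ω Y : Set ℂ) : ℝ :=
  sSup { x : ℝ | ∃ w ∈ Ω, x = hurwitzDensity Y w / hurwitzDensity Ω w }

/-- The global contraction constant `gl_η(Ω, Y)`. -/
def glEta (Ω Y : Set ℂ) : ℝ :=
  sSup { x : ℝ | ∃ w₁ ∈ Ω, ∃ w₂ ∈ Ω, w₁ ≠ w₂ ∧
    x = hurwitzDist Y w₁ w₂ / hurwitzDist Ω w₁ w₂ }

/-- The set of admissible derivatives at the origin whose supremum is the Hurwitz radius. -/
def hurwitzRadiusSet (Ω : Set ℂ) (w : ℂ) : Set ℝ :=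
  { r : ℝ | 0 < r ∧ ∃ h : ℂ → ℂ, DifferentiableOn ℂ h unitDisk ∧
    Set.MapsTo h unitDisk Ω ∧ h 0 = w ∧ (∀ t ∈ unitDisk, t ≠ 0 → h t ≠ w) ∧
    deriv h 0 = (r : ℂ) }

lemma hurwitzRadius_eq_sSup (Ω : Set ℂ) (w : ℂ) :
    hurwitzRadius Ω w = sSup (hurwitzRadiusSet Ω w) := rfl

lemma hurwitzRadius_nonneg (Ω : Set ℂ) (w : ℂ) : 0 ≤ hurwitzRadius Ω w :=
  Real.sSup_nonneg fun _ hr ↦ hr.1.le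

lemma mem_unitDisk {z : ℂ} : z ∈ unitDisk ↔ ‖z‖ < 1 := by simp [unitDisk]

lemma isOpen_unitDisk : IsOpen unitDisk := Metric.isOpen_ball

lemma zero_mem_unitDisk : (0 : ℂ) ∈ unitDisk := by simp [unitDisk]

/-- The normalization `h'(0) > 0` can be achieved by a rotation of the disk. -/
lemma norm_deriv_mem_hurwitzRadiusSet {Ω : Set ℂ} {w : ℂ} {h : ℂ → ℂ}
    (hd : DifferentiableOn ℂ h unitDisk) (hm : MapsTo h unitDisk Ω) (h0 : h 0 = w)
    (hne : ∀ t ∈ unitDisk, t ≠ 0 → h t ≠ w) (hd0 : deriv h 0 ≠ 0) :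
    ‖deriv h 0‖ ∈ hurwitzRadiusSet Ω w := by
  set d := deriv h 0 with hdef
  have hn : (‖d‖ : ℂ) ≠ 0 := by simpa using hd0
  set c : ℂ := ‖d‖ / d with hc
  have hc1 : ‖c‖ = 1 := by simp [hc, hd0]
  have hc0 : c ≠ 0 := by rw [← norm_ne_zero_iff, hc1]; exact one_ne_zero
  have hmem : ∀ t ∈ unitDisk, c * t ∈ unitDisk := by
    intro t ht
    rw [mem_unitDisk] at *
    simpa [hc1] using ht
  refine ⟨norm_pos_iff.2 hd0, fun t ↦ h (c * t), ?_, fun t ht ↦ hm (hmem t ht), by simpa using h0,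
    fun t ht ht0 ↦ hne _ (hmem t ht) (mul_ne_zero hc0 ht0), ?_⟩
  · exact hd.comp (by fun_prop) hmem
  · rw [deriv_comp_mul_left c h, mul_zero, ← hdef, smul_eq_mul, hc,
      div_mul_cancel₀ _ hd0]

lemma hurwitzRadiusSet_nonempty {Ω : Set ℂ} {w : ℂ} (hΩ : IsOpen Ω) (hw : w ∈ Ω) :
    (hurwitzRadiusSet Ω w).Nonempty := by
  obtain ⟨δ, hδ, hball⟩ := Metric.isOpen_iff.1 hΩ w hw
  have hδ' : (δ : ℂ) ≠ 0 := by exact_mod_cast hδ.ne'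
  refine ⟨δ, hδ, fun t ↦ w + δ * t, by fun_prop, fun t ht ↦ hball ?_, by simp, ?_, ?_⟩
  · rw [mem_unitDisk] at ht
    simp only [mem_ball, dist_self_add_left, norm_mul, norm_real, Real.norm_of_nonneg hδ.le]
    nlinarith
  · intro t _ ht
    simp [ht, hδ']
  · simp

/-- The disk automorphism sending `a` to `0`. -/
def diskShift (a z : ℂ) : ℂ := (z - a) / (1 - (starRingEnd ℂ) a * z)

section diskShift

variable {a z : ℂ}

lemma one_sub_conj_mul_ne_zero (ha : ‖a‖ < 1) (hz : ‖z‖ < 1) :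
    1 - (starRingEnd ℂ) a * z ≠ 0 := by
  intro h
  have h1 : ‖(starRingEnd ℂ) a * z‖ = 1 := by rw [← sub_eq_zero.1 h, norm_one]
  rw [norm_mul, RCLike.norm_conj] at h1
  nlinarith [norm_nonneg a, norm_nonneg z]

lemma norm_diskShift_lt_one (ha : ‖a‖ < 1) (hz : ‖z‖ < 1) : ‖diskShift a z‖ < 1 := by
  have hne := one_sub_conj_mul_ne_zero ha hz
  rw [diskShift, norm_div, div_lt_one (norm_pos_iff.2 hne)]
  refine lt_of_pow_lt_pow_left₀ 2 (norm_nonneg _) ?_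
  rw [Complex.sq_norm, Complex.sq_norm]
  have h1 : normSq a < 1 := by rw [← Complex.sq_norm]; nlinarith [norm_nonneg a]
  have h2 : normSq z < 1 := by rw [← Complex.sq_norm]; nlinarith [norm_nonneg z]
  simp only [normSq_apply, sub_re, sub_im, mul_re, mul_im, conj_re, conj_im, one_re, one_im]
    at h1 h2 ⊢
  nlinarith [mul_pos (sub_pos.2 h1) (sub_pos.2 h2)]

lemma hasDerivAt_diskShift (ha : ‖a‖ < 1) (hz : ‖z‖ < 1) :
    HasDerivAt (diskShift a) ((1 - ‖a‖ ^ 2) / (1 - (starRingEnd ℂ) a * z) ^ 2) z := by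
  have hne := one_sub_conj_mul_ne_zero ha hz
  have h := ((hasDerivAt_id z).sub_const a).div
    (((hasDerivAt_id z).const_mul ((starRingEnd ℂ) a)).const_sub 1) hne
  refine h.congr_deriv ?_
  rw [← Complex.conj_mul']
  simp only [id]
  congr 1
  ring

lemma one_sub_norm_sq_ne_zero (ha : ‖a‖ < 1) : (1 - ‖a‖ ^ 2 : ℂ) ≠ 0 := by
  have : (1 - ‖a‖ ^ 2 : ℝ) ≠ 0 := by nlinarith [norm_nonneg a]
  exact_mod_cast this

lemma eq_of_diskShift_eq (ha : ‖a‖ < 1) {w : ℂ} (hz : ‖z‖ < 1) (hw : ‖w‖ < 1)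
    (h : diskShift a z = diskShift a w) : z = w := by
  have hz' := one_sub_conj_mul_ne_zero ha hz
  have hw' := one_sub_conj_mul_ne_zero ha hw
  rw [diskShift, diskShift, div_eq_div_iff hz' hw'] at h
  have h2 : (z - w) * (1 - (starRingEnd ℂ) a * a) = 0 := by linear_combination h
  rw [Complex.conj_mul', mul_eq_zero] at h2
  exact sub_eq_zero.1 (h2.resolve_right (one_sub_norm_sq_ne_zero ha))

@[simp] lemma diskShift_self : diskShift a a = 0 := by simp [diskShift]

end diskShift

/-- On a simply connected open set, a nonvanishing holomorphic function has a holomorphic square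
root. -/
lemma exists_hasDerivAt_sqrt {U : Set ℂ} (hUo : IsOpen U) (hUc : IsSimplyConnected U) {f : ℂ → ℂ}
    (hf : DifferentiableOn ℂ f U) (h0 : ∀ z ∈ U, f z ≠ 0) :
    ∃ g : ℂ → ℂ, (∀ z, g z ^ 2 = f z) ∧
      ∀ z ∈ U, HasDerivAt g (deriv f z / (2 * g z)) z := by
  obtain ⟨g, hgc, hg⟩ := Complex.exists_continuousOn_pow_eq hUc hUo hf.continuousOn
    (by rintro ⟨z, hz, h⟩; exact h0 z hz h) two_ne_zero
  refine ⟨g, hg, fun z hz ↦ ?_⟩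
  have hsq : HasStrictDerivAt (fun y : ℂ ↦ y ^ 2) (2 * g z) (g z) := by
    simpa using hasStrictDerivAt_pow 2 (g z)
  have h2 : 2 * g z ≠ 0 := mul_ne_zero two_ne_zero fun h ↦ h0 z hz (by
    rw [← hg z, h, zero_pow two_ne_zero])
  have hinv : HasDerivAt (hsq.localInverse _ _ _ h2) (2 * g z)⁻¹ (f z) := by
    simpa only [hg z] using (hsq.to_localInverse h2).hasDerivAt
  have hcomp := hinv.comp z (hf.differentiableAt (hUo.mem_nhds hz)).hasDerivAt
  refine (hcomp.congr_of_eventuallyEq ?_).congr_deriv (by rw [div_eq_inv_mul])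
  filter_upwards [(hgc.continuousAt (hUo.mem_nhds hz)).eventually
    (hsq.eventually_left_inverse h2)] with y hy
  rw [Function.comp_apply, ← hg y, hy]

/-- `F` embeds `U` conformally into the unit disk. -/
structure IsDiskEmbedding (U : Set ℂ) (F : ℂ → ℂ) : Prop where
  mapsTo : MapsTo F U unitDisk
  injOn : InjOn F U
  deriv_ne_zero : ∀ z ∈ U, deriv F z ≠ 0

namespace IsDiskEmbedding

variable {U : Set ℂ} {F : ℂ → ℂ} {s : ℂ}

lemma differentiableAt (hF : IsDiskEmbedding U F) {z : ℂ} (hz : z ∈ U) : DifferentiableAt ℂ F z :=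
  differentiableAt_of_deriv_ne_zero (hF.deriv_ne_zero z hz)

lemma differentiableOn (hF : IsDiskEmbedding U F) : DifferentiableOn ℂ F U :=
  fun _ hz ↦ (hF.differentiableAt hz).differentiableWithinAt

lemma diskShift_comp (hF : IsDiskEmbedding U F) {a : ℂ} (ha : ‖a‖ < 1) :
    IsDiskEmbedding U (diskShift a ∘ F) := by
  have hn : ∀ z ∈ U, ‖F z‖ < 1 := fun z hz ↦ mem_unitDisk.1 (hF.mapsTo hz)
  refine ⟨fun z hz ↦ mem_unitDisk.2 (norm_diskShift_lt_one ha (hn z hz)), fun z hz w hw h ↦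
    hF.injOn hz hw (eq_of_diskShift_eq ha (hn z hz) (hn w hw) h), fun z hz ↦ ?_⟩
  rw [((hasDerivAt_diskShift ha (hn z hz)).comp z (hF.differentiableAt hz).hasDerivAt).deriv]
  exact mul_ne_zero (div_ne_zero (one_sub_norm_sq_ne_zero ha)
    (pow_ne_zero _ (one_sub_conj_mul_ne_zero ha (hn z hz)))) (hF.deriv_ne_zero z hz)

/-- A disk embedding that omits `0` has a square root which is again a disk embedding. -/
lemma exists_sqrt (hUo : IsOpen U) (hUc : IsSimplyConnected U) (hF : IsDiskEmbedding U F)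
    (h0 : ∀ z ∈ U, F z ≠ 0) :
    ∃ G, IsDiskEmbedding U G ∧ (∀ z ∈ U, G z ^ 2 = F z) ∧
      ∀ z ∈ U, deriv G z = deriv F z / (2 * G z) := by
  obtain ⟨G, hG, hroot⟩ := exists_hasDerivAt_sqrt hUo hUc hF.differentiableOn h0
  refine ⟨G, ⟨fun z hz ↦ ?_, fun z hz w hw h ↦ hF.injOn hz hw (by rw [← hG z, ← hG w, h]),
    fun z hz ↦ ?_⟩, fun z _ ↦ hG z, fun z hz ↦ (hroot z hz).deriv⟩
  · have := mem_unitDisk.1 (hF.mapsTo hz)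
    rw [← hG z, norm_pow] at this
    exact mem_unitDisk.2 ((pow_lt_one_iff_of_nonneg (norm_nonneg _) two_ne_zero).1 this)
  · rw [(hroot z hz).deriv]
    refine div_ne_zero (hF.deriv_ne_zero z hz) (mul_ne_zero two_ne_zero fun h ↦ h0 z hz ?_)
    rw [← hG z, h, zero_pow two_ne_zero]

/-- Koebe's construction: an embedding omitting a point of the disk can be expanded at its zero. -/
lemma exists_expansion (hUo : IsOpen U) (hUc : IsSimplyConnected U) (hF : IsDiskEmbedding U F)
    (hs : s ∈ U) (hFs : F s = 0) {a : ℂ} (ha : ‖a‖ < 1) (haF : a ∉ F '' U) :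
    ∃ G β, IsDiskEmbedding U G ∧ G s = 0 ∧ 0 < β ∧ β ^ 2 = ‖a‖ ∧
      ‖deriv G s‖ * (2 * β) = ‖deriv F s‖ * (1 + β ^ 2) := by
  have hn : ∀ z ∈ U, ‖F z‖ < 1 := fun z hz ↦ mem_unitDisk.1 (hF.mapsTo hz)
  obtain ⟨R, hR, hsq, hder⟩ := exists_sqrt hUo hUc (hF.diskShift_comp ha) (by
    intro z hz h
    refine haF ⟨z, hz, eq_of_diskShift_eq ha (hn z hz) ha ?_⟩
    simpa using h)
  set b := R s with hb
  have hb1 : ‖b‖ < 1 := mem_unitDisk.1 (hR.mapsTo hs)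
  have hb2 : b ^ 2 = -a := by simpa [hFs, diskShift] using hsq s hs
  have hbn : ‖b‖ ^ 2 = ‖a‖ := by rw [← norm_pow, hb2, norm_neg]
  have ha0 : a ≠ 0 := fun h ↦ haF ⟨s, hs, by rw [hFs, h]⟩
  have hb0 : b ≠ 0 := by
    rintro h
    rw [h] at hb2
    exact ha0 (by simpa using hb2.symm)
  have hbpos : 0 < ‖b‖ := norm_pos_iff.2 hb0
  refine ⟨diskShift b ∘ R, ‖b‖, hR.diskShift_comp hb1, by simp [← hb], hbpos, hbn, ?_⟩
  have d1 : deriv (diskShift a ∘ F) s = (1 - ‖a‖ ^ 2 : ℝ) * deriv F s := by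
    rw [((hasDerivAt_diskShift ha (hn s hs)).comp s (hF.differentiableAt hs).hasDerivAt).deriv,
      hFs]
    simp
  have hbb : 1 - ‖b‖ ^ 2 ≠ 0 := by nlinarith
  have d2 : deriv (diskShift b ∘ R) s = ((1 - ‖b‖ ^ 2)⁻¹ : ℝ) * deriv R s := by
    rw [((hasDerivAt_diskShift hb1 (hb ▸ hb1)).comp s (hR.differentiableAt hs).hasDerivAt).deriv,
      ← hb, Complex.conj_mul']
    push_cast
    have := one_sub_norm_sq_ne_zero hb1
    field_simp
  rw [d2, hder s hs, d1, ← hb, norm_mul, norm_div, norm_mul, norm_mul, norm_real, norm_real,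
    Real.norm_of_nonneg (sub_nonneg.2 (pow_le_one₀ (norm_nonneg a) ha.le)),
    Real.norm_of_nonneg (inv_nonneg.2 (sub_nonneg.2 (pow_le_one₀ (norm_nonneg b) hb1.le))), ← hbn]
  simp only [RCLike.norm_ofNat]
  field_simp
  ring

lemma norm_deriv_le_one_div (hF : IsDiskEmbedding U F) (hFs : F s = 0) {δ : ℝ} (hδ : 0 < δ)
    (hball : ball s δ ⊆ U) : ‖deriv F s‖ ≤ 1 / δ :=
  Complex.norm_deriv_le_div_of_mapsTo_ball (hF.differentiableOn.mono hball)
    (fun z hz ↦ by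
      rw [hFs]
      exact ball_subset_closedBall (hF.mapsTo (hball hz))) hδ

end IsDiskEmbedding

/-- A simply connected proper subdomain of the plane embeds into the unit disk. -/
lemma exists_isDiskEmbedding {U : Set ℂ} (hUo : IsOpen U) (hUc : IsSimplyConnected U)
    (hU : U ≠ univ) : ∃ F, IsDiskEmbedding U F := by
  obtain ⟨a, ha⟩ := (ne_univ_iff_exists_notMem U).1 hU
  obtain ⟨x, hx⟩ := hUc.nonempty
  have hne : ∀ z ∈ U, z - a ≠ 0 := fun z hz h ↦ ha (sub_eq_zero.1 h ▸ hz)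
  obtain ⟨g, hg, hgd⟩ := exists_hasDerivAt_sqrt (f := fun z ↦ z - a) hUo hUc (by fun_prop) hne
  have hg0 : ∀ z ∈ U, g z ≠ 0 := fun z hz h ↦ hne z hz (by rw [← hg z, h, zero_pow two_ne_zero])
  have hderiv : ∀ z ∈ U, deriv g z ≠ 0 := fun z hz ↦ by
    rw [(hgd z hz).deriv]
    simpa using hg0 z hz
  have hinj : ∀ z w, g z ^ 2 = g w ^ 2 → z = w := fun z w h ↦ by
    rw [hg, hg] at h
    exact sub_left_injective h
  have hgon : DifferentiableOn ℂ g U := fun z hz ↦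
    (hgd z hz).differentiableAt.differentiableWithinAt
  have hnhds : g '' U ∈ nhds (g x) := by
    rw [← (hgon.analyticAt (hUo.mem_nhds hx)).hasStrictDerivAt.map_nhds_eq (hderiv x hx)]
    exact Filter.image_mem_map (hUo.mem_nhds hx)
  obtain ⟨ε, hε, hball⟩ := Metric.mem_nhds_iff.1 hnhds
  have hfar : ∀ z ∈ U, ε ≤ ‖g z + g x‖ := by
    intro z hz
    by_contra! hlt
    obtain ⟨y, hy, hyz⟩ := hball (show -g z ∈ ball (g x) ε by
      rw [mem_ball_iff_norm, ← norm_neg]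
      rwa [show -(-g z - g x) = g z + g x by ring])
    obtain rfl : y = z := hinj y z (by rw [hyz, neg_sq])
    exact hg0 y hy (by linear_combination hyz / 2)
  have hsum : ∀ z ∈ U, g z + g x ≠ 0 := fun z hz ↦ norm_pos_iff.1 (hε.trans_le (hfar z hz))
  have hε' : ((ε / 2 : ℝ) : ℂ) ≠ 0 := by exact_mod_cast (half_pos hε).ne'
  refine ⟨fun z ↦ (ε / 2 : ℝ) / (g z + g x), fun z hz ↦ ?_, fun z hz w hw h ↦ ?_, fun z hz ↦ ?_⟩
  · rw [mem_unitDisk, norm_div, norm_real, Real.norm_of_nonneg (half_pos hε).le,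
      div_lt_one (norm_pos_iff.2 (hsum z hz))]
    exact (half_lt_self hε).trans_le (hfar z hz)
  · refine hinj z w ?_
    have h' := (div_eq_div_iff (hsum z hz) (hsum w hw)).1 h
    rw [add_right_cancel (mul_left_cancel₀ hε' h')]
  · rw [((hasDerivAt_const z _).fun_div
      ((hgd z hz).differentiableAt.hasDerivAt.add_const _) (hsum z hz)).deriv]
    simpa [hsum z hz, hε.ne'] using hderiv z hz

/-- A weak form of the Riemann mapping theorem: a simply connected proper subdomain of the plane
has conformal embeddings into the unit disk which send a given point to the origin and whose image
covers an arbitrarily large concentric disk. -/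
lemma exists_isDiskEmbedding_ball_subset_image {U : Set ℂ} (hUo : IsOpen U)
    (hUc : IsSimplyConnected U) (hU : U ≠ univ) {s : ℂ} (hs : s ∈ U) {ρ : ℝ} (hρ0 : 0 < ρ)
    (hρ : ρ < 1) : ∃ F, IsDiskEmbedding U F ∧ F s = 0 ∧ ball 0 ρ ⊆ F '' U := by
  set S : Set ℝ := {x | ∃ F, IsDiskEmbedding U F ∧ F s = 0 ∧ x = ‖deriv F s‖}
  obtain ⟨δ, hδ, hball⟩ := Metric.isOpen_iff.1 hUo s hs
  have hbdd : BddAbove S := ⟨1 / δ, by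
    rintro _ ⟨F, hF, hFs, rfl⟩
    exact hF.norm_deriv_le_one_div hFs hδ hball⟩
  obtain ⟨F₀, hF₀⟩ := exists_isDiskEmbedding hUo hUc hU
  have hF₁ := hF₀.diskShift_comp (mem_unitDisk.1 (hF₀.mapsTo hs))
  have hmem : ‖deriv (diskShift (F₀ s) ∘ F₀) s‖ ∈ S := ⟨_, hF₁, by simp, rfl⟩
  have hM : 0 < sSup S := (norm_pos_iff.2 (hF₁.deriv_ne_zero s hs)).trans_le (le_csSup hbdd hmem)
  set σ := √ρ
  have hσ0 : 0 < σ := Real.sqrt_pos.2 hρ0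
  have hσ2 : σ ^ 2 = ρ := Real.sq_sqrt hρ0.le
  have hσ1 : σ < 1 := by nlinarith
  have hκ : 2 * σ / (1 + σ ^ 2) < 1 := by
    rw [div_lt_one (by positivity)]
    nlinarith [mul_pos (sub_pos.2 hσ1) (sub_pos.2 hσ1)]
  obtain ⟨_, ⟨F, hF, hFs, rfl⟩, hlt⟩ :=
    exists_lt_of_lt_csSup ⟨_, hmem⟩ (show 2 * σ / (1 + σ ^ 2) * sSup S < sSup S by nlinarith)
  refine ⟨F, hF, hFs, fun a ha ↦ by_contra fun haF ↦ ?_⟩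
  rw [mem_ball_zero_iff] at ha
  obtain ⟨G, β, hG, hGs, hβ, hβa, hGd⟩ :=
    hF.exists_expansion hUo hUc hs hFs (ha.trans hρ) haF
  have hle : ‖deriv G s‖ ≤ sSup S := le_csSup hbdd ⟨G, hG, hGs, rfl⟩
  have hβσ : β < σ := lt_of_pow_lt_pow_left₀ 2 hσ0.le (by rw [hβa, hσ2]; exact ha)
  rw [div_mul_eq_mul_div, div_lt_iff₀ (by positivity)] at hlt
  have hmono : (1 + σ ^ 2) * β ≤ (1 + β ^ 2) * σ := by
    nlinarith [mul_pos (sub_pos.2 hβσ) (show 0 < 1 - σ * β by nlinarith)]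
  have h1 := mul_le_mul_of_nonneg_left hmono (norm_nonneg (deriv F s))
  have h2 := mul_lt_mul_of_pos_right hlt hβ
  have h3 := mul_le_mul_of_nonneg_right hle (mul_pos hσ0 hβ).le
  have h4 : ‖deriv F s‖ * ((1 + β ^ 2) * σ) = ‖deriv G s‖ * (σ * β) * 2 := by
    linear_combination (-σ) * hGd
  nlinarith

namespace IsDiskEmbedding

variable {U : Set ℂ} {F : ℂ → ℂ} {s : ℂ}

lemma bddAbove_hurwitzRadiusSet (hF : IsDiskEmbedding U F) (hs : s ∈ U) (hFs : F s = 0) :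
    BddAbove (hurwitzRadiusSet U s) := by
  have hF0 : 0 < ‖deriv F s‖ := norm_pos_iff.2 (hF.deriv_ne_zero s hs)
  refine ⟨1 / ‖deriv F s‖, ?_⟩
  rintro r ⟨hr, f, hfd, hfm, hf0, -, hfr⟩
  have hf : DifferentiableAt ℂ f 0 :=
    hfd.differentiableAt (isOpen_unitDisk.mem_nhds zero_mem_unitDisk)
  have hder : deriv (F ∘ f) 0 = deriv F s * r := by
    rw [deriv_comp 0 (hf0.symm ▸ hF.differentiableAt hs) hf, hf0, hfr]
  have h1 : ‖deriv (F ∘ f) 0‖ ≤ 1 := by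
    refine Complex.norm_deriv_le_one_of_mapsTo_ball (hF.differentiableOn.comp hfd hfm)
      (fun z hz ↦ ?_) one_pos
    rw [Function.comp_apply, Function.comp_apply, hf0, hFs]
    exact ball_subset_closedBall (hF.mapsTo (hfm hz))
  rw [hder, norm_mul, norm_real, Real.norm_of_nonneg hr.le] at h1
  rw [le_div_iff₀ hF0]
  linarith

lemma div_mem_hurwitzRadiusSet (hUo : IsOpen U) (hF : IsDiskEmbedding U F) (hs : s ∈ U)
    (hFs : F s = 0) {ρ : ℝ} (hρ : 0 < ρ) (hball : ball 0 ρ ⊆ F '' U) :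
    ρ / ‖deriv F s‖ ∈ hurwitzRadiusSet U s := by
  set K := Function.invFunOn F U
  have hK : ∀ z ∈ U, K (F z) = z := hF.injOn.leftInvOn_invFunOn
  have hKd : ∀ z ∈ U, HasDerivAt K (deriv F z)⁻¹ (F z) := fun z hz ↦ by
    have hst : HasStrictDerivAt F (deriv F z) z :=
      (hF.differentiableOn.analyticAt (hUo.mem_nhds hz)).hasStrictDerivAt
    exact (hst.to_local_left_inverse (hF.deriv_ne_zero z hz) (by
      filter_upwards [hUo.mem_nhds hz] with y hy using hK y hy)).hasDerivAt
  have hρn : ∀ t ∈ unitDisk, ∃ z ∈ U, F z = ρ * t := fun t ht ↦ by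
    refine hball ?_
    rw [mem_unitDisk] at ht
    rw [mem_ball_zero_iff, norm_mul, norm_real, Real.norm_of_nonneg hρ.le]
    nlinarith
  have hρ' : (ρ : ℂ) ≠ 0 := by exact_mod_cast hρ.ne'
  have hKs : K 0 = s := by rw [← hFs, hK s hs]
  have hder : deriv (fun t : ℂ ↦ K (ρ * t)) 0 = ρ * (deriv F s)⁻¹ := by
    have := (hKd s hs).deriv
    rw [hFs] at this
    rw [deriv_comp_mul_left (ρ : ℂ) K, mul_zero, this, smul_eq_mul]
  have hnorm : ρ / ‖deriv F s‖ = ‖deriv (fun t : ℂ ↦ K (ρ * t)) 0‖ := by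
    rw [hder, norm_mul, norm_inv, norm_real, Real.norm_of_nonneg hρ.le, div_eq_mul_inv]
  rw [hnorm]
  refine norm_deriv_mem_hurwitzRadiusSet (fun t ht ↦ ?_) (fun t ht ↦ ?_) (by simpa using hKs)
    (fun t ht ht0 h ↦ ?_) ?_
  · obtain ⟨z, hz, hzt⟩ := hρn t ht
    have h1 := (hKd z hz).differentiableAt
    rw [hzt] at h1
    exact (h1.comp t (by fun_prop : DifferentiableAt ℂ (fun t : ℂ ↦ ρ * t) t)).differentiableWithinAt
  · obtain ⟨z, hz, hzt⟩ := hρn t ht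
    simpa [← hzt, hK z hz] using hz
  · obtain ⟨z, hz, hzt⟩ := hρn t ht
    simp only [← hzt, hK z hz] at h
    rw [h, hFs] at hzt
    exact mul_ne_zero hρ' ht0 hzt.symm
  · rw [hder]
    exact mul_ne_zero hρ' (inv_ne_zero (hF.deriv_ne_zero s hs))

end IsDiskEmbedding

lemma hurwitzDensity_le_div_norm_deriv {Y Ω : Set ℂ} (hY : IsOpen Y) {s w : ℂ} (hs : s ∈ Y)
    {h : ℂ → ℂ} (hd : DifferentiableOn ℂ h Y) (hm : MapsTo h Y Ω) (hsw : h s = w)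
    (hne : ∀ t ∈ Y, t ≠ s → h t ≠ w) (hds : deriv h s ≠ 0) :
    hurwitzDensity Ω w ≤ hurwitzDensity Y s / ‖deriv h s‖ := by
  have hpos : 0 < ‖deriv h s‖ := norm_pos_iff.2 hds
  have hmul : ∀ r ∈ hurwitzRadiusSet Y s, r * ‖deriv h s‖ ∈ hurwitzRadiusSet Ω w := by
    rintro r ⟨hr, f, hfd, hfm, hf0, hfne, hfr⟩
    have hf : DifferentiableAt ℂ f 0 :=
      hfd.differentiableAt (isOpen_unitDisk.mem_nhds zero_mem_unitDisk)
    have hder : deriv (h ∘ f) 0 = deriv h s * r := by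
      rw [deriv_comp 0 (hf0.symm ▸ hd.differentiableAt (hY.mem_nhds hs)) hf, hf0, hfr]
    have hr' : (r : ℂ) ≠ 0 := by exact_mod_cast hr.ne'
    have := norm_deriv_mem_hurwitzRadiusSet (hd.comp hfd hfm) (hm.comp hfm)
      (show (h ∘ f) 0 = w by rw [Function.comp_apply, hf0, hsw])
      (fun t ht ht0 ↦ hne _ (hfm ht) (hfne t ht ht0))
      (by rw [hder]; exact mul_ne_zero hds hr')
    rwa [hder, norm_mul, norm_real, Real.norm_of_nonneg hr.le, mul_comm] at this
  by_cases hb : BddAbove (hurwitzRadiusSet Ω w)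
  · have hle : ∀ r ∈ hurwitzRadiusSet Y s, r ≤ hurwitzRadius Ω w / ‖deriv h s‖ := fun r hr ↦ by
      rw [le_div_iff₀ hpos]
      exact le_csSup hb (hmul r hr)
    obtain ⟨r₀, hr₀⟩ := hurwitzRadiusSet_nonempty hY hs
    have hYpos : 0 < hurwitzRadius Y s := hr₀.1.trans_le (le_csSup ⟨_, hle⟩ hr₀)
    have hYle : hurwitzRadius Y s ≤ hurwitzRadius Ω w / ‖deriv h s‖ := csSup_le ⟨r₀, hr₀⟩ hle
    rw [le_div_iff₀ hpos] at hYle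
    rw [hurwitzDensity, hurwitzDensity, div_div]
    exact div_le_div_of_nonneg_left zero_le_two (by positivity) hYle
  · rw [hurwitzDensity, hurwitzRadius_eq_sSup, Real.sSup_of_not_bddAbove hb, div_zero]
    exact div_nonneg (div_nonneg zero_le_two (hurwitzRadius_nonneg _ _)) hpos.le

lemma genHurwitzDensity_le_of_mem {Y Yhat Ω : Set ℂ} (hYhat : IsOpen Yhat)
    (hsc : IsSimplyConnected Yhat) (hsub : Y ⊆ Yhat) (hqb : Yhat ≠ univ)
    (hnl : lEta Y Yhat = 1) {w : ℂ} {q : ℝ} (hq : q ∈ hurwitzRadiusSet Ω w) {μ : ℝ} (hμ0 : 0 < μ)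
    (hμ : μ < 1) : genHurwitzDensity Y Ω w ≤ ENNReal.ofReal (2 / (q * (μ * μ))) := by
  obtain ⟨hq0, g, hgd, hgm, hg0, hgne, hgq⟩ := hq
  have hne : { x : ℝ | ∃ w ∈ Y, x = hurwitzDensity Yhat w / hurwitzDensity Y w }.Nonempty := by
    by_contra hemp
    rw [not_nonempty_iff_eq_empty] at hemp
    rw [lEta, hemp, Real.sSup_empty] at hnl
    exact zero_ne_one hnl
  obtain ⟨_, ⟨s, hs, rfl⟩, hlt⟩ := exists_lt_of_lt_csSup hne (hnl.symm ▸ hμ : μ < lEta Y Yhat)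
  have hs' := hsub hs
  obtain ⟨F, hF, hFs, hball⟩ :=
    exists_isDiskEmbedding_ball_subset_image hYhat hsc hqb hs' hμ0 hμ
  have hF0 : 0 < ‖deriv F s‖ := norm_pos_iff.2 (hF.deriv_ne_zero s hs')
  have hR : μ / ‖deriv F s‖ ≤ hurwitzRadius Yhat s :=
    le_csSup (hF.bddAbove_hurwitzRadiusSet hs' hFs)
      (hF.div_mem_hurwitzRadiusSet hYhat hs' hFs hμ0 hball)
  have hRpos : 0 < hurwitzRadius Yhat s := (div_pos hμ0 hF0).trans_le hR
  have hYpos : 0 < hurwitzRadius Y s := by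
    refine (hurwitzRadius_nonneg _ _).lt_of_ne' fun h ↦ ?_
    rw [hurwitzDensity, hurwitzDensity, h, div_zero, div_zero] at hlt
    exact hlt.not_gt hμ0
  have hlt' : μ * hurwitzRadius Yhat s < hurwitzRadius Y s := by
    rw [hurwitzDensity, hurwitzDensity, div_div_div_cancel_left' _ _ two_ne_zero,
      lt_div_iff₀ hRpos] at hlt
    exact hlt
  have hq' : (q : ℂ) ≠ 0 := by exact_mod_cast hq0.ne'
  have hg : DifferentiableAt ℂ g 0 :=
    hgd.differentiableAt (isOpen_unitDisk.mem_nhds zero_mem_unitDisk)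
  have hder : deriv (g ∘ F) s = q * deriv F s := by
    rw [deriv_comp s (hFs.symm ▸ hg) (hF.differentiableAt hs'), hFs, hgq]
  have hmem : genHurwitzDensity Y Ω w ≤
      ENNReal.ofReal (hurwitzDensity Y s / ‖deriv (g ∘ F) s‖) := by
    refine sInf_le ⟨s, hs, g ∘ F, hgd.comp (hF.differentiableOn.mono hsub)
      (hF.mapsTo.mono_left hsub), fun t ht ↦ hgm (hF.mapsTo (hsub ht)), ?_, fun t ht hts ↦
      hgne _ (hF.mapsTo (hsub ht)) fun h ↦ hts ?_, ?_, rfl⟩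
    · rw [Function.comp_apply, hFs, hg0]
    · exact hF.injOn (hsub ht) hs' (h.trans hFs.symm)
    · rw [hder]
      exact mul_ne_zero hq' (hF.deriv_ne_zero s hs')
  refine hmem.trans (ENNReal.ofReal_le_ofReal ?_)
  rw [hder, norm_mul, norm_real, Real.norm_of_nonneg hq0.le, hurwitzDensity, div_div]
  refine div_le_div_of_nonneg_left zero_le_two (by positivity) ?_
  rw [div_le_iff₀ hF0] at hR
  have h1 : μ * μ ≤ hurwitzRadius Y s * ‖deriv F s‖ := by
    have h2 := mul_le_mul_of_nonneg_left hR hμ0.le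
    have h3 := mul_le_mul_of_nonneg_right hlt'.le hF0.le
    linarith
  nlinarith [mul_le_mul_of_nonneg_left h1 hq0.le]

lemma exists_lt_mem_hurwitzRadiusSet {Ω : Set ℂ} (hΩ : IsOpen Ω) {w : ℂ} (hw : w ∈ Ω) {x : ℝ}
    (hx : hurwitzDensity Ω w < x) : ∃ q ∈ hurwitzRadiusSet Ω w, 2 / x < q := by
  by_cases hb : BddAbove (hurwitzRadiusSet Ω w)
  · have hne := hurwitzRadiusSet_nonempty hΩ hw
    obtain ⟨r, hr⟩ := hne
    have hpos : 0 < hurwitzRadius Ω w := hr.1.trans_le (le_csSup hb hr)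
    have hx0 : 0 < x := (div_pos two_pos hpos).trans hx
    refine exists_lt_of_lt_csSup ⟨r, hr⟩ ?_
    rw [hurwitzDensity, div_lt_iff₀ hpos] at hx
    rwa [← hurwitzRadius_eq_sSup, div_lt_iff₀ hx0, mul_comm]
  · obtain ⟨q, hq, h⟩ := not_bddAbove_iff.1 hb (2 / x)
    exact ⟨q, hq, h⟩

/-- if `Y` is quasi-bounded (with hull `Yhat`, the smallest simply
connected plane domain containing `Y`, a proper subset of `ℂ`) and Hurwitz
non-Lipschitz in `Yhat`, then `η_Ω^Y = η_Ω` on any proper subdomain `Ω` of `ℂ`. -/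
theorem genHurwitz_eq_hurwitz_of_quasiBounded_nonLipschitz
    (Ω Y Yhat : Set ℂ) (hΩ : IsPlaneDomain Ω) (hΩp : Ω ≠ Set.univ)
    (hY : IsPlaneDomain Y)
    (hYhat : IsPlaneDomain Yhat) (hsc : SimplyConnectedSpace ↥Yhat)
    (hsub : Y ⊆ Yhat)
    (hmin : ∀ S : Set ℂ, IsPlaneDomain S → SimplyConnectedSpace ↥S → Y ⊆ S → Yhat ⊆ S)
    (hqb : Yhat ≠ Set.univ) (hnl : lEta Y Yhat = 1) :
    ∀ w ∈ Ω, genHurwitzDensity Y Ω w = ENNReal.ofReal (hurwitzDensity Ω w) := by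
  intro w hw
  have hη : 0 ≤ hurwitzDensity Ω w := div_nonneg zero_le_two (hurwitzRadius_nonneg _ _)
  apply le_antisymm
  · refine ENNReal.le_of_forall_pos_le_add fun ε hε _ ↦ ?_
    have hx : hurwitzDensity Ω w < hurwitzDensity Ω w + ε := by
      simpa using hε
    have hx0 := hη.trans_lt hx
    obtain ⟨q, hq, hlt⟩ := exists_lt_mem_hurwitzRadiusSet hΩ.1 hw hx
    have hq0 : 0 < q := hq.1
    set x := hurwitzDensity Ω w + ε with hxdef
    have hl : 0 < 2 / x / q := by positivity
    have hl1 : 2 / x / q < 1 := (div_lt_one hq0).2 hlt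
    refine (genHurwitzDensity_le_of_mem hYhat.1 hsc hsub hqb hnl hq (Real.sqrt_pos.2 hl)
      ((Real.sqrt_lt' one_pos).2 (by simpa using hl1))).trans_eq ?_
    have hqx : 2 / (q * (2 / x / q)) = x := by field_simp
    rw [Real.mul_self_sqrt hl.le, hqx, hxdef, ENNReal.ofReal_add hη ε.coe_nonneg,
      ENNReal.ofReal_coe_nnreal]
  · refine le_sInf ?_
    rintro _ ⟨s, hs, h, hd, hm, hsw, hne, hds, rfl⟩
    exact ENNReal.ofReal_le_ofReal
      (hurwitzDensity_le_div_norm_deriv hY.1 hs hd hm hsw hne hds)
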